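/- arXiv:2410.13729 — 3 statements merged into one kernel-verified Lean document; each statement's English description precedes it below -/
import Mathlib

section
/- Let i be an odd integer with i ≡ 1 (mod 4) and i ≥ 5 (so that (i+1)/2 is odd), and set B(i) = {(i+1)/2, (i+1)/2 + 2, …, i}. Then S(i) = ⋂_{j ∈ B(i)} T(j), and this is a factorization of S(i) into irreducibles; that is, each T(j) is irreducible and S(i) ≠ ⋂_{j ∈ J} T(j) for every proper subset J of B(i). -/
/-- A numerical semigroup: a submonoid of `(ℕ, +)` with finite complement. -/
structure NumericalSemigroup where
  carrier : Set ℕ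
  zero_mem : 0 ∈ carrier
  add_mem : ∀ ⦃a b : ℕ⦄, a ∈ carrier → b ∈ carrier → a + b ∈ carrier
  cofinite : (carrierᶜ : Set ℕ).Finite

/-- A numerical semigroup is irreducible if it is not the intersection of two
numerical semigroups properly containing it. -/
def NumericalSemigroup.Irred (S : NumericalSemigroup) : Prop :=
  ¬ ∃ A B : NumericalSemigroup,
      S.carrier ⊂ A.carrier ∧ S.carrier ⊂ B.carrier ∧
      S.carrier = A.carrier ∩ B.carrier

/-- `F : Fin n → NumericalSemigroup` is a factorization of `S` (of length `n`)
into irreducibles: each factor is irreducible, `S` is the intersection of the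
factors, and the intersection cannot be refined (no proper subfamily has
intersection `S`). -/
def IsFactorization (S : NumericalSemigroup) {n : ℕ}
    (F : Fin n → NumericalSemigroup) : Prop :=
  (∀ j, (F j).Irred) ∧
  S.carrier = ⋂ j, (F j).carrier ∧
  ∀ J : Set (Fin n), J ≠ Set.univ → S.carrier ≠ ⋂ j ∈ J, (F j).carrier

/-- `S` admits a factorization into irreducibles of length `n`. -/
def HasFactorizationOfLength (S : NumericalSemigroup) (n : ℕ) : Prop :=
  ∃ F : Fin n → NumericalSemigroup, IsFactorization S F

/-- The set of lengths `Lᵐ(S)` of factorizations of `S` into irreducibles. -/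
def LengthSet (S : NumericalSemigroup) : Set ℕ :=
  {n | HasFactorizationOfLength S n}

/-- The underlying set of `T(m) = {0} ∪ {(m+1)/2, …, m-1} ∪ {m+1, m+2, …}`. -/
def Tset (m : ℕ) : Set ℕ :=
  {0} ∪ Set.Icc ((m + 1) / 2) (m - 1) ∪ Set.Ici (m + 1)

/-- The underlying set of the numerical semigroup `⟨2, m⟩` generated by `2` and `m`. -/
def gen2 (m : ℕ) : Set ℕ := {n | ∃ a b : ℕ, n = 2 * a + m * b}

/-- The underlying set of `S(i) = ⟨2, i⟩ ∩ T(i)`. -/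
def Sset (i : ℕ) : Set ℕ := gen2 i ∩ Tset i

/-- The set of special gaps of `S`: gaps `g` such that `S ∪ {g}` is again a
numerical semigroup. -/
def SpecialGaps (S : NumericalSemigroup) : Set ℕ :=
  {g | g ∉ S.carrier ∧ ∃ T : NumericalSemigroup, T.carrier = insert g S.carrier}

theorem mem_Tset_iff {m : ℕ} (hm : 1 ≤ m) (n : ℕ) :
    n ∈ Tset m ↔ n = 0 ∨ ((m + 1) / 2 ≤ n ∧ n ≠ m) := by
  simp only [Tset, Set.mem_union, Set.mem_singleton_iff, Set.mem_Icc, Set.mem_Ici]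
  omega

theorem mem_gen2_iff {m : ℕ} (hm : m % 2 = 1) (n : ℕ) :
    n ∈ gen2 m ↔ n % 2 = 0 ∨ m ≤ n := by
  constructor
  · rintro ⟨a, b, rfl⟩
    rcases b with _ | b
    · left; omega
    · right; nlinarith
  · intro h
    rcases Nat.mod_two_eq_zero_or_one n with hn | hn
    · exact ⟨n / 2, 0, by omega⟩
    · exact ⟨(n - m) / 2, 1, by omega⟩

/-- Every numerical semigroup properly containing `T(m)`, with `m` odd, contains `m`. -/
theorem mem_of_Tset_ssubset {m : ℕ} (hm : m % 2 = 1) {A : NumericalSemigroup}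
    (h : Tset m ⊂ A.carrier) : m ∈ A.carrier := by
  obtain ⟨x, hxA, hxT⟩ := Set.exists_of_ssubset h
  rw [mem_Tset_iff (by omega)] at hxT
  by_cases hx : x = m
  · exact hx ▸ hxA
  · have hmem : m - x ∈ A.carrier :=
      h.subset ((mem_Tset_iff (by omega) _).2 (by omega))
    have hadd := A.add_mem hxA hmem
    rwa [Nat.add_sub_cancel' (by omega)] at hadd

theorem NumericalSemigroup.irred_of_carrier_eq_Tset {m : ℕ} (hm : m % 2 = 1)
    {T : NumericalSemigroup} (hT : T.carrier = Tset m) : T.Irred := by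
  rintro ⟨A, B, hA, hB, hAB⟩
  rw [hT] at hA hB hAB
  have hmem : m ∈ Tset m :=
    hAB ▸ ⟨mem_of_Tset_ssubset hm hA, mem_of_Tset_ssubset hm hB⟩
  rw [mem_Tset_iff (by omega)] at hmem
  omega

/-- For odd `i ≡ 1 (mod 4)`, `i ≥ 5`, with
`B(i) = {(i+1)/2, (i+1)/2 + 2, …, i}`, one has `S(i) = ⋂_{j ∈ B(i)} T(j)`,
each `T(j)` is irreducible, and the intersection cannot be refined. -/
theorem factorization_Si_full_case_odd (i : ℕ) (hi : i % 4 = 1) (hi5 : 5 ≤ i) :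
    (Sset i = ⋂ j ∈ {j : ℕ | ∃ m ≤ (i - 1) / 4, j = (i + 1) / 2 + 2 * m}, Tset j) ∧
    (∀ j ∈ {j : ℕ | ∃ m ≤ (i - 1) / 4, j = (i + 1) / 2 + 2 * m},
      ∀ T : NumericalSemigroup, T.carrier = Tset j → T.Irred) ∧
    (∀ J : Set ℕ, J ⊂ {j : ℕ | ∃ m ≤ (i - 1) / 4, j = (i + 1) / 2 + 2 * m} →
      Sset i ≠ ⋂ j ∈ J, Tset j) := by
  refine ⟨?_, ?_, ?_⟩
  · ext n
    simp only [Sset, Set.mem_inter_iff, Set.mem_iInter]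
    rw [mem_gen2_iff (by omega), mem_Tset_iff (by omega)]
    constructor
    · rintro ⟨h₁, h₂⟩ j ⟨m, hm, rfl⟩
      rw [mem_Tset_iff (by omega)]
      omega
    · intro h
      have hi_mem := h i ⟨(i - 1) / 4, le_rfl, by omega⟩
      rw [mem_Tset_iff (by omega)] at hi_mem
      refine ⟨?_, hi_mem⟩
      by_contra hn
      have hn_mem := h n ⟨(n - (i + 1) / 2) / 2, by omega, by omega⟩
      rw [mem_Tset_iff (by omega)] at hn_mem
      omega
  · rintro j ⟨m, hm, rfl⟩ T hT
    exact NumericalSemigroup.irred_of_carrier_eq_Tset (by omega) hT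
  · intro J hJ hS
    obtain ⟨k, ⟨m, hm, rfl⟩, hkJ⟩ := Set.exists_of_ssubset hJ
    have hk : (i + 1) / 2 + 2 * m ∈ Sset i := by
      rw [hS]
      simp only [Set.mem_iInter]
      intro j hj
      have hne : (i + 1) / 2 + 2 * m ≠ j := fun h => hkJ (h ▸ hj)
      obtain ⟨l, hl, rfl⟩ := hJ.subset hj
      rw [mem_Tset_iff (by omega)]
      omega
    rw [Sset, Set.mem_inter_iff, mem_gen2_iff (by omega), mem_Tset_iff (by omega)] at hk
    omega
end

section
/- Let k be an integer greater than one and set i = 4k − 1. Then the set of lengths of factorizations of S(i) into irreducibles contains every integer from 2 to k; that is, {2, 3, …, k} ⊆ Lᵐ(S(4k−1)). -/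
theorem mem_Tset {m x : ℕ} :
    x ∈ Tset m ↔ x = 0 ∨ ((m + 1) / 2 ≤ x ∧ x ≤ m - 1) ∨ m + 1 ≤ x := by
  simp [Tset, or_assoc]

theorem mem_gen2_of_odd {m x : ℕ} (hm : m % 2 = 1) :
    x ∈ gen2 m ↔ x % 2 = 0 ∨ m ≤ x := by
  constructor
  · rintro ⟨a, b, rfl⟩
    rcases Nat.eq_zero_or_pos b with rfl | hb
    · simp
    · have := Nat.le_mul_of_pos_right m hb
      omega
  · intro h
    by_cases hx : x % 2 = 0
    · exact ⟨x / 2, 0, by omega⟩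
    · exact ⟨(x - m) / 2, 1, by omega⟩

/-- The numerical semigroup `⟨2, m⟩` for odd `m`. -/
def NumericalSemigroup.genTwo (m : ℕ) (hm : m % 2 = 1) : NumericalSemigroup where
  carrier := gen2 m
  zero_mem := ⟨0, 0, rfl⟩
  add_mem := by
    rintro _ _ ⟨a, b, rfl⟩ ⟨c, d, rfl⟩
    exact ⟨a + c, b + d, by ring⟩
  cofinite := (Set.finite_Iio m).subset fun x hx => by
    simp only [Set.mem_compl_iff, mem_gen2_of_odd hm, Set.mem_Iio] at hx ⊢
    omega

/-- The numerical semigroup `T(m)` for odd `m`. -/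
def NumericalSemigroup.upperHalf (m : ℕ) (hm : m % 2 = 1) : NumericalSemigroup where
  carrier := Tset m
  zero_mem := mem_Tset.2 (Or.inl rfl)
  add_mem := by
    intro a b ha hb
    rw [mem_Tset] at *
    omega
  cofinite := (Set.finite_Iic m).subset fun x hx => by
    simp only [Set.mem_compl_iff, mem_Tset, Set.mem_Iic] at hx ⊢
    omega

/-- A symmetric numerical semigroup is irreducible. -/
theorem NumericalSemigroup.irred_of_symmetric (S : NumericalSemigroup) (f : ℕ)
    (hf : f ∉ S.carrier) (hsymm : ∀ x ∉ S.carrier, ∃ y ∈ S.carrier, x + y = f) :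
    S.Irred := by
  have mem_of_ssubset : ∀ A : NumericalSemigroup, S.carrier ⊂ A.carrier → f ∈ A.carrier := by
    intro A hA
    obtain ⟨x, hxA, hxS⟩ := Set.exists_of_ssubset hA
    obtain ⟨y, hy, rfl⟩ := hsymm x hxS
    exact A.add_mem hxA (hA.1 hy)
  rintro ⟨A, B, hA, hB, hAB⟩
  exact hf (hAB ▸ ⟨mem_of_ssubset A hA, mem_of_ssubset B hB⟩)

theorem NumericalSemigroup.irred_genTwo (m : ℕ) (hm : m % 2 = 1) (h3 : 3 ≤ m) :
    (genTwo m hm).Irred := by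
  refine irred_of_symmetric _ (m - 2) ?_ ?_
  · simp only [genTwo, mem_gen2_of_odd hm]
    omega
  · intro x hx
    simp only [genTwo, mem_gen2_of_odd hm] at hx ⊢
    exact ⟨m - 2 - x, by omega, by omega⟩

theorem NumericalSemigroup.irred_upperHalf (m : ℕ) (hm : m % 2 = 1) :
    (upperHalf m hm).Irred := by
  refine irred_of_symmetric _ m ?_ ?_
  · simp only [upperHalf, mem_Tset]
    omega
  · intro x hx
    simp only [upperHalf, mem_Tset] at hx ⊢
    exact ⟨m - x, by omega, by omega⟩

/-- A family of irreducibles with intersection `S` is a factorization as soon as each member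
excludes some gap of `S` that all the other members contain. -/
theorem isFactorization_of_witness {S : NumericalSemigroup} {n : ℕ}
    {F : Fin n → NumericalSemigroup} (hirr : ∀ j, (F j).Irred)
    (hS : S.carrier = ⋂ j, (F j).carrier) (w : Fin n → ℕ) (hw : ∀ j, w j ∉ S.carrier)
    (hmem : ∀ j l, l ≠ j → w j ∈ (F l).carrier) : IsFactorization S F := by
  refine ⟨hirr, hS, fun J hJ hSJ => ?_⟩
  obtain ⟨j, hj⟩ := (Set.ne_univ_iff_exists_notMem J).1 hJ
  refine hw j (hSJ ▸ Set.mem_iInter₂.2 fun l hl => hmem j l ?_)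
  rintro rfl
  exact hj hl

/-- For an integer `k > 1` and `i = 4k - 1`, the set of lengths of
factorizations of `S(i)` into irreducibles contains every integer from `2` to `k`. -/
theorem lengths_interval (k : ℕ) (hk : 1 < k)
    (S : NumericalSemigroup) (hS : S.carrier = Sset (4 * k - 1)) :
    Set.Icc 2 k ⊆ LengthSet S := by
  rintro n ⟨hn2, hnk⟩
  have hSmem : ∀ x, x ∈ S.carrier ↔ x = 0 ∨ (2 * k ≤ x ∧ x % 2 = 0) ∨ 4 * k ≤ x := by
    intro x
    rw [hS, Sset, Set.mem_inter_iff, mem_gen2_of_odd (by omega), mem_Tset]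
    omega
  -- `⟨2, c + 2⟩` excludes the odd numbers up to `c`, and `T(c + 2 j)` excludes `c + 2 j`.
  obtain ⟨c, hc⟩ : ∃ c, c + 2 * n = 4 * k + 1 := ⟨4 * k + 1 - 2 * n, by omega⟩
  let F : Fin n → NumericalSemigroup := fun j =>
    if (j : ℕ) = 0 then .genTwo (c + 2) (by omega) else .upperHalf (c + 2 * j) (by omega)
  have hF_zero : ∀ j : Fin n, (j : ℕ) = 0 → ∀ x,
      x ∈ (F j).carrier ↔ x % 2 = 0 ∨ c + 2 ≤ x := by
    intro j hj x
    simp only [F, hj, if_true, NumericalSemigroup.genTwo]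
    exact mem_gen2_of_odd (by omega)
  have hF_pos : ∀ j : Fin n, (j : ℕ) ≠ 0 → ∀ x, x ∈ (F j).carrier ↔
      x = 0 ∨ ((c + 2 * j + 1) / 2 ≤ x ∧ x ≤ c + 2 * j - 1) ∨ c + 2 * j + 1 ≤ x := by
    intro j hj x
    simp only [F, hj, if_false, NumericalSemigroup.upperHalf, mem_Tset]
  refine ⟨F, isFactorization_of_witness ?_ ?_ (fun j => c + 2 * j) ?_ ?_⟩
  · intro j
    by_cases hj : (j : ℕ) = 0
    · simp only [F, hj, if_true]
      exact NumericalSemigroup.irred_genTwo _ _ (by omega)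
    · simp only [F, hj, if_false]
      exact NumericalSemigroup.irred_upperHalf _ _
  · ext x
    rw [hSmem, Set.mem_iInter]
    constructor
    · intro hx j
      by_cases hj : (j : ℕ) = 0
      · rw [hF_zero j hj]
        omega
      · rw [hF_pos j hj]
        omega
    · intro hx
      have h_first := (hF_zero ⟨0, by omega⟩ rfl x).1 (hx _)
      have h_last := (hF_pos ⟨n - 1, by omega⟩ (by simp only; omega) x).1 (hx _)
      simp only at h_last
      by_contra hxS
      have hj : (x - c) / 2 < n := by omega
      have h_mid := (hF_pos ⟨(x - c) / 2, hj⟩ (by simp only; omega) x).1 (hx _)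
      simp only at h_mid
      omega
  · intro j
    rw [hSmem]
    omega
  · intro j l hlj
    have hne : (l : ℕ) ≠ j := Fin.val_ne_of_ne hlj
    by_cases hl : (l : ℕ) = 0
    · rw [hF_zero l hl]
      omega
    · rw [hF_pos l hl]
      omega
end

section
/- Let i be an odd integer with i ≡ 3 (mod 4) and i ≥ 7 (so that (i+1)/2 is even). Then every gap g of S(i) with g > (i+1)/2 has the form g = (i+1)/2 + 2k + 1 for some integer k ≥ 0, and every such gap is a special gap of S(i) (i.e., S(i) ∪ {g} is a numerical semigroup). -/
/-- For odd `m`, the nonzero elements of `S(m)` are the even numbers at least `(m + 1) / 2`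
together with all numbers above `m`. -/
theorem mem_Sset_iff {m : ℕ} (hm : m % 2 = 1) (n : ℕ) :
    n ∈ Sset m ↔ n = 0 ∨ (n % 2 = 0 ∧ (m + 1) / 2 ≤ n) ∨ m < n := by
  simp only [Sset, gen2, Tset, Set.mem_inter_iff, Set.mem_ofPred_eq, Set.mem_union,
    Set.mem_singleton_iff, Set.mem_Icc, Set.mem_Ici]
  constructor
  · rintro ⟨⟨a, b, hab⟩, h⟩
    rcases Nat.eq_zero_or_pos b with rfl | hb
    · omega
    · have := Nat.le_mul_of_pos_right m hb
      omega
  · intro h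
    refine ⟨?_, by omega⟩
    rcases Nat.mod_two_eq_zero_or_one n with hn | hn
    · exact ⟨n / 2, 0, by omega⟩
    · exact ⟨(n - m) / 2, 1, by omega⟩

/-- For odd `i ≡ 3 (mod 4)`, `i ≥ 7`, every gap `g` of `S(i)` with
`g > (i+1)/2` is of the form `(i+1)/2 + 2k + 1`, and every such gap is a special
gap of `S(i)`. -/
theorem gaps_above_half_are_special (i : ℕ) (hi : i % 4 = 3) (hi7 : 7 ≤ i)
    (S : NumericalSemigroup) (hS : S.carrier = Sset i)
    (g : ℕ) (hg : g ∉ Sset i) (hgt : (i + 1) / 2 < g) :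
    (∃ k : ℕ, g = (i + 1) / 2 + 2 * k + 1) ∧
    ∃ T : NumericalSemigroup, T.carrier = insert g S.carrier := by
  have hodd : i % 2 = 1 := by omega
  rw [mem_Sset_iff hodd] at hg
  refine ⟨⟨(g - (i + 1) / 2 - 1) / 2, by omega⟩, ⟨insert g S.carrier, Or.inr S.zero_mem, ?_,
    S.cofinite.subset (Set.compl_subset_compl.mpr (Set.subset_insert _ _))⟩, rfl⟩
  intro a b ha hb
  rw [hS] at ha hb ⊢
  simp only [Set.mem_insert_iff, mem_Sset_iff hodd] at ha hb ⊢
  omega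
end
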